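/- Let {σ^(k)}_{k=1,...,n} be n spin configurations drawn i.i.d. from an Ising model with zero magnetic field on p spins with maximum degree d and maximum coupling intensity β, and fix a node u ∈ V. For any ε₃ > 0, if n ≥ exp(2βd)·ln(2p/ε₃), then with probability at least 1 − ε₃ the gradient of the Interaction Screening Objective at the true coupling vector satisfies ‖∇S_n(θ*_u)‖_∞ ≤ 2·√(ln(2p/ε₃)/n). -/

import Mathlib

open scoped BigOperators Classical

noncomputable section

/-- The ±1 spin value associated to a Boolean. -/
def spin (b : Bool) : ℝ := if b then 1 else -1

/-- The energy term of the zero-field Ising model with (symmetric, zero-diagonal)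
couplings `θ`: the sum over undirected edges of `θ i j * σ_i * σ_j`. -/
def ham {p : ℕ} (θ : Fin p → Fin p → ℝ) (σ : Fin p → Bool) : ℝ :=
  (1 / 2) * ∑ i, ∑ j, θ i j * spin (σ i) * spin (σ j)

/-- The Gibbs probability `μ(σ) = exp(ham θ σ) / Z`. -/
def gibbs {p : ℕ} (θ : Fin p → Fin p → ℝ) (σ : Fin p → Bool) : ℝ :=
  Real.exp (ham θ σ) / ∑ τ : Fin p → Bool, Real.exp (ham θ τ)

/-- Probability of the event `P` under `n` i.i.d. samples from the Ising model. -/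
def probn {p : ℕ} (θ : Fin p → Fin p → ℝ) (n : ℕ)
    (P : (Fin n → Fin p → Bool) → Prop) : ℝ :=
  ∑ σs : Fin n → Fin p → Bool, if P σs then ∏ k, gibbs θ (σs k) else 0

/-- The Interaction Screening Objective at node `u`. -/
def ISO {p : ℕ} (n : ℕ) (σs : Fin n → Fin p → Bool) (u : Fin p) (θu : Fin p → ℝ) : ℝ :=
  (1 / n : ℝ) *
    ∑ k, Real.exp (-∑ i ∈ Finset.univ.erase u, θu i * spin (σs k u) * spin (σs k i))

/-- The gradient (vector of partial derivatives) of the Interaction Screening Objective. -/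
def gradISO {p : ℕ} (n : ℕ) (σs : Fin n → Fin p → Bool) (u : Fin p) (θu : Fin p → ℝ)
    (l : Fin p) : ℝ :=
  (1 / n : ℝ) *
    ∑ k, (-(spin (σs k u) * spin (σs k l))) *
      Real.exp (-∑ i ∈ Finset.univ.erase u, θu i * spin (σs k u) * spin (σs k i))

/-- ℓ₁-norm of a coupling vector around node `u` (the `u`-entry is excluded). -/
def l1 {p : ℕ} (u : Fin p) (x : Fin p → ℝ) : ℝ := ∑ i ∈ Finset.univ.erase u, |x i|

/-- ℓ₂-norm of a coupling vector around node `u` (the `u`-entry is excluded). -/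
def l2 {p : ℕ} (u : Fin p) (x : Fin p → ℝ) : ℝ :=
  Real.sqrt (∑ i ∈ Finset.univ.erase u, x i ^ 2)

lemma spin_sq (b : Bool) : spin b * spin b = 1 := by cases b <;> simp [spin]

lemma spin_abs (b : Bool) : |spin b| = 1 := by cases b <;> simp [spin]

lemma spin_not (b : Bool) : spin (!b) = - spin b := by cases b <;> simp [spin]

/-- flip the spin at `u` -/
def flipAt {p : ℕ} (u : Fin p) (σ : Fin p → Bool) : Fin p → Bool :=
  Function.update σ u (!σ u)

lemma flipAt_same {p : ℕ} (u : Fin p) (σ : Fin p → Bool) : flipAt u σ u = !σ u := by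
  simp [flipAt]

lemma flipAt_ne {p : ℕ} {u i : Fin p} (h : i ≠ u) (σ : Fin p → Bool) :
    flipAt u σ i = σ i := by
  simp [flipAt, h]

lemma flipAt_inv {p : ℕ} (u : Fin p) : Function.Involutive (flipAt u) := by
  intro σ
  ext i
  by_cases h : i = u
  · subst h; simp [flipAt_same]
  · simp [flipAt_ne h]

/-- local energy at `u` -/
def locE {p : ℕ} (θ : Fin p → Fin p → ℝ) (u : Fin p) (σ : Fin p → Bool) : ℝ :=
  ∑ i ∈ Finset.univ.erase u, θ u i * spin (σ u) * spin (σ i)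

lemma locE_flip {p : ℕ} (θ : Fin p → Fin p → ℝ) (u : Fin p) (σ : Fin p → Bool) :
    locE θ u (flipAt u σ) = - locE θ u σ := by
  unfold locE
  rw [← Finset.sum_neg_distrib]
  refine Finset.sum_congr rfl fun i hi => ?_
  rw [flipAt_same, flipAt_ne (Finset.ne_of_mem_erase hi), spin_not]
  ring

lemma ham_split {p : ℕ} (θ : Fin p → Fin p → ℝ) (hsymm : ∀ i j, θ i j = θ j i)
    (hdiag : ∀ i, θ i i = 0) (u : Fin p) (σ : Fin p → Bool) :
    ham θ σ = locE θ u σ + (1 / 2) * ∑ i ∈ Finset.univ.erase u, ∑ j ∈ Finset.univ.erase u,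
      θ i j * spin (σ i) * spin (σ j) := by
  unfold ham
  rw [← Finset.add_sum_erase Finset.univ _ (Finset.mem_univ u)]
  have h1 : ∀ i, ∑ j, θ i j * spin (σ i) * spin (σ j) = θ i u * spin (σ i) * spin (σ u)
      + ∑ j ∈ Finset.univ.erase u, θ i j * spin (σ i) * spin (σ j) := fun i =>
    (Finset.add_sum_erase Finset.univ _ (Finset.mem_univ u)).symm
  simp only [h1, Finset.sum_add_distrib, hdiag]
  have h2 : ∑ i ∈ Finset.univ.erase u, θ i u * spin (σ i) * spin (σ u) = locE θ u σ := by
    unfold locE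
    refine Finset.sum_congr rfl fun i _ => ?_
    rw [hsymm i u]; ring
  rw [h2]
  unfold locE
  ring

lemma ham_flip {p : ℕ} (θ : Fin p → Fin p → ℝ) (hsymm : ∀ i j, θ i j = θ j i)
    (hdiag : ∀ i, θ i i = 0) (u : Fin p) (σ : Fin p → Bool) :
    ham θ (flipAt u σ) = ham θ σ - 2 * locE θ u σ := by
  rw [ham_split θ hsymm hdiag u, ham_split θ hsymm hdiag u σ, locE_flip]
  have : ∑ i ∈ Finset.univ.erase u, ∑ j ∈ Finset.univ.erase u,
      θ i j * spin (flipAt u σ i) * spin (flipAt u σ j) =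
      ∑ i ∈ Finset.univ.erase u, ∑ j ∈ Finset.univ.erase u,
      θ i j * spin (σ i) * spin (σ j) := by
    refine Finset.sum_congr rfl fun i hi => Finset.sum_congr rfl fun j hj => ?_
    rw [flipAt_ne (Finset.ne_of_mem_erase hi), flipAt_ne (Finset.ne_of_mem_erase hj)]
  rw [this]; ring

/-- single sample gradient contribution -/
def gX {p : ℕ} (θ : Fin p → Fin p → ℝ) (u l : Fin p) (σ : Fin p → Bool) : ℝ :=
  (-(spin (σ u) * spin (σ l))) * Real.exp (-locE θ u σ)

lemma Z_pos {p : ℕ} (θ : Fin p → Fin p → ℝ) :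
    0 < ∑ τ : Fin p → Bool, Real.exp (ham θ τ) :=
  Finset.sum_pos (fun _ _ => Real.exp_pos _) Finset.univ_nonempty

lemma gibbs_nonneg {p : ℕ} (θ : Fin p → Fin p → ℝ) (σ : Fin p → Bool) : 0 ≤ gibbs θ σ :=
  div_nonneg (Real.exp_pos _).le (Z_pos θ).le

lemma gibbs_sum {p : ℕ} (θ : Fin p → Fin p → ℝ) : ∑ σ, gibbs θ σ = 1 := by
  unfold gibbs
  rw [← Finset.sum_div]
  exact div_self (Z_pos θ).ne'

lemma sum_flip {p : ℕ} (u : Fin p) (f : (Fin p → Bool) → ℝ) :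
    ∑ σ, f (flipAt u σ) = ∑ σ, f σ :=
  Equiv.sum_comp (flipAt_inv u).toPerm f

lemma gibbs_flip {p : ℕ} (θ : Fin p → Fin p → ℝ) (hsymm : ∀ i j, θ i j = θ j i)
    (hdiag : ∀ i, θ i i = 0) (u : Fin p) (σ : Fin p → Bool) :
    gibbs θ (flipAt u σ) = gibbs θ σ * Real.exp (-locE θ u σ) ^ 2 := by
  unfold gibbs
  rw [ham_flip θ hsymm hdiag, sq, ← Real.exp_add, div_mul_eq_mul_div, ← Real.exp_add]
  congr 2
  ring

lemma gX_mean {p : ℕ} (θ : Fin p → Fin p → ℝ) (hsymm : ∀ i j, θ i j = θ j i)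
    (hdiag : ∀ i, θ i i = 0) (u l : Fin p) (hl : l ≠ u) :
    ∑ σ, gibbs θ σ * gX θ u l σ = 0 := by
  have h := sum_flip u (fun σ => gibbs θ σ * gX θ u l σ)
  have h2 : ∀ σ, gibbs θ (flipAt u σ) * gX θ u l (flipAt u σ) = - (gibbs θ σ * gX θ u l σ) := by
    intro σ
    rw [gibbs_flip θ hsymm hdiag]
    unfold gX
    rw [locE_flip, flipAt_same, flipAt_ne hl, spin_not, neg_neg]
    have : Real.exp (-locE θ u σ) * Real.exp (locE θ u σ) = 1 := by
      rw [← Real.exp_add]; simp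
    linear_combination (gibbs θ σ * Real.exp (-locE θ u σ) * spin (σ u) * spin (σ l)) * this
  simp only [h2, Finset.sum_neg_distrib] at h
  linarith

lemma gX_sq {p : ℕ} (θ : Fin p → Fin p → ℝ) (hsymm : ∀ i j, θ i j = θ j i)
    (hdiag : ∀ i, θ i i = 0) (u l : Fin p) :
    ∑ σ, gibbs θ σ * gX θ u l σ ^ 2 = 1 := by
  rw [← gibbs_sum θ, ← sum_flip u (gibbs θ)]
  refine Finset.sum_congr rfl fun σ _ => ?_
  rw [gibbs_flip θ hsymm hdiag]
  unfold gX
  have h1 := spin_sq (σ u)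
  have h2 := spin_sq (σ l)
  have : (-(spin (σ u) * spin (σ l))) ^ 2 = 1 := by
    calc _ = (spin (σ u) * spin (σ u)) * (spin (σ l) * spin (σ l)) := by ring
      _ = 1 := by rw [h1, h2, one_mul]
  rw [mul_pow, this, one_mul]

lemma locE_abs {p : ℕ} (d : ℕ) (β : ℝ) (θ : Fin p → Fin p → ℝ)
    (hdeg : ∀ i, (Finset.univ.filter fun j => θ i j ≠ 0).card ≤ d)
    (hβ : ∀ i j, |θ i j| ≤ β) (u : Fin p) (σ : Fin p → Bool) : |locE θ u σ| ≤ β * d := by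
  have hβ0 : 0 ≤ β := (abs_nonneg _).trans (hβ u u)
  calc |locE θ u σ| ≤ ∑ i ∈ Finset.univ.erase u, |θ u i * spin (σ u) * spin (σ i)| :=
        Finset.abs_sum_le_sum_abs _ _
    _ = ∑ i ∈ Finset.univ.erase u, |θ u i| := by
        simp only [abs_mul, spin_abs, mul_one]
    _ ≤ ∑ i, |θ u i| := Finset.sum_le_sum_of_subset_of_nonneg (Finset.subset_univ _)
        (fun _ _ _ => abs_nonneg _)
    _ = ∑ i ∈ Finset.univ.filter (fun j => θ u j ≠ 0), |θ u i| := by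
        rw [Finset.sum_filter]
        refine Finset.sum_congr rfl fun i _ => ?_
        by_cases h : θ u i = 0 <;> simp [h]
    _ ≤ (Finset.univ.filter (fun j => θ u j ≠ 0)).card • β :=
        Finset.sum_le_card_nsmul _ _ _ fun i _ => hβ u i
    _ ≤ β * d := by
        rw [nsmul_eq_mul, mul_comm]
        exact mul_le_mul_of_nonneg_left (by exact_mod_cast hdeg u) hβ0

lemma gX_abs {p : ℕ} (d : ℕ) (β : ℝ) (θ : Fin p → Fin p → ℝ)
    (hdeg : ∀ i, (Finset.univ.filter fun j => θ i j ≠ 0).card ≤ d)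
    (hβ : ∀ i j, |θ i j| ≤ β) (u l : Fin p) (σ : Fin p → Bool) :
    |gX θ u l σ| ≤ Real.exp (β * d) := by
  unfold gX
  rw [abs_mul, abs_neg, abs_mul, spin_abs, spin_abs, Real.abs_exp, one_mul, one_mul]
  exact Real.exp_le_exp.2 ((neg_le_abs _).trans (locE_abs d β θ hdeg hβ u σ))

lemma exp_quad {x : ℝ} (hx : |x| ≤ 1) : Real.exp x ≤ 1 + x + x ^ 2 := by
  have := (abs_le.1 (Real.abs_exp_sub_one_sub_id_le hx)).2
  linarith

lemma mgf_one {α : Type*} [Fintype α] (w X : α → ℝ) (hw : ∀ a, 0 ≤ w a) (h1 : ∑ a, w a = 1)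
    (h2 : ∑ a, w a * X a = 0) (h3 : ∑ a, w a * X a ^ 2 = 1) (s : ℝ)
    (hs : ∀ a, |s * X a| ≤ 1) : ∑ a, w a * Real.exp (s * X a) ≤ Real.exp (s ^ 2) := by
  calc ∑ a, w a * Real.exp (s * X a) ≤ ∑ a, w a * (1 + s * X a + (s * X a) ^ 2) :=
        Finset.sum_le_sum fun a _ => mul_le_mul_of_nonneg_left (exp_quad (hs a)) (hw a)
    _ = ∑ a, (w a + s * (w a * X a) + s ^ 2 * (w a * X a ^ 2)) :=
        Finset.sum_congr rfl fun a _ => by ring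
    _ = s ^ 2 + 1 := by
        rw [Finset.sum_add_distrib, Finset.sum_add_distrib, ← Finset.mul_sum, ← Finset.mul_sum,
          h1, h2, h3]; ring
    _ ≤ Real.exp (s ^ 2) := Real.add_one_le_exp _

lemma mgf_n {α : Type*} [Fintype α] (w X : α → ℝ) (hw : ∀ a, 0 ≤ w a) (h1 : ∑ a, w a = 1)
    (h2 : ∑ a, w a * X a = 0) (h3 : ∑ a, w a * X a ^ 2 = 1) (s : ℝ)
    (hs : ∀ a, |s * X a| ≤ 1) (n : ℕ) :
    ∑ σs : Fin n → α, (∏ k, w (σs k)) * Real.exp (s * ∑ k, X (σs k))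
      ≤ Real.exp (n * s ^ 2) := by
  have : ∀ σs : Fin n → α, (∏ k, w (σs k)) * Real.exp (s * ∑ k, X (σs k)) =
      ∏ k, (w (σs k) * Real.exp (s * X (σs k))) := by
    intro σs
    rw [Finset.prod_mul_distrib, Finset.mul_sum, Real.exp_sum]
  simp only [this]
  rw [← Fintype.sum_pow (fun a => w a * Real.exp (s * X a)), Real.exp_nat_mul]
  exact pow_le_pow_left₀ (Finset.sum_nonneg fun a _ => mul_nonneg (hw a) (Real.exp_pos _).le)
    (mgf_one w X hw h1 h2 h3 s hs) n

/-- **Lemma 4 (gradient concentration).**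
Let `σ^(1), …, σ^(n)` be i.i.d. samples from a zero-field Ising model on `p` spins with
maximum degree `d` and maximum coupling intensity `β`, and fix a node `u`. For any `ε₃ > 0`,
if `n ≥ exp(2βd) ln(2p/ε₃)` then with probability at least `1 - ε₃`,
`‖∇S_n(θ*_u)‖_∞ ≤ 2 √(ln(2p/ε₃)/n)`. -/
theorem stmt7 {p : ℕ} (n d : ℕ) (β ε₃ : ℝ) (θ : Fin p → Fin p → ℝ)
    (hsymm : ∀ i j, θ i j = θ j i) (hdiag : ∀ i, θ i i = 0)
    (hdeg : ∀ i, (Finset.univ.filter fun j => θ i j ≠ 0).card ≤ d)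
    (hβ : ∀ i j, |θ i j| ≤ β)
    (u : Fin p) (hε₃ : 0 < ε₃)
    (hn : (n : ℝ) ≥ Real.exp (2 * β * d) * Real.log (2 * p / ε₃)) :
    probn θ n (fun σs =>
      ∀ l ∈ Finset.univ.erase u,
        |gradISO n σs u (fun i => θ u i) l| ≤ 2 * Real.sqrt (Real.log (2 * p / ε₃) / n))
      ≥ 1 - ε₃ := by
  have hp1 : (1 : ℝ) ≤ p := by exact_mod_cast (Nat.succ_le_of_lt (Fin.pos u))
  have hW : ∀ σs : Fin n → Fin p → Bool, 0 ≤ ∏ k, gibbs θ (σs k) := fun σs =>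
    Finset.prod_nonneg fun k _ => gibbs_nonneg θ _
  set L := Real.log (2 * p / ε₃) with hL
  by_cases hε : 1 ≤ ε₃
  · refine ge_iff_le.2 (le_trans (by linarith) (Finset.sum_nonneg fun σs _ => ?_))
    split_ifs
    · exact hW σs
    · exact le_rfl
  push Not at hε
  have hL0 : 0 < L := Real.log_pos (by rw [lt_div_iff₀ hε₃]; linarith)
  have hexpL : Real.exp (-L) = ε₃ / (2 * p) := by
    rw [Real.exp_neg, hL, Real.exp_log (by positivity), inv_div]
  have hn0 : (0 : ℝ) < n := lt_of_lt_of_le (by positivity) hn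
  set s := Real.sqrt (L / n) with hsdef
  have hs0 : 0 ≤ s := Real.sqrt_nonneg _
  have hs2 : n * s ^ 2 = L := by
    rw [hsdef, Real.sq_sqrt (by positivity)]; field_simp
  have hsM : s * Real.exp (β * d) ≤ 1 := by
    have h : (s * Real.exp (β * d)) ^ 2 ≤ 1 := by
      have e : Real.exp (β * d) ^ 2 = Real.exp (2 * β * d) := by
        rw [sq, ← Real.exp_add]; congr 1; ring
      rw [mul_pow, e, hsdef, Real.sq_sqrt (by positivity), div_mul_eq_mul_div,
        div_le_one hn0]
      linarith
    nlinarith [mul_nonneg hs0 (Real.exp_pos (β * d)).le]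
  have hsX : ∀ l σ, |s * gX θ u l σ| ≤ 1 := fun l σ => by
    rw [abs_mul, abs_of_nonneg hs0]
    exact (mul_le_mul_of_nonneg_left (gX_abs d β θ hdeg hβ u l σ) hs0).trans hsM
  have hsX' : ∀ l σ, |(-s) * gX θ u l σ| ≤ 1 := fun l σ => by
    rw [neg_mul, abs_neg]; exact hsX l σ
  have hm : ∀ l ∈ Finset.univ.erase u, ∑ σs : Fin n → Fin p → Bool, (∏ k, gibbs θ (σs k)) *
      (Real.exp (s * ∑ k, gX θ u l (σs k)) + Real.exp (-s * ∑ k, gX θ u l (σs k)))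
      ≤ 2 * Real.exp L := by
    intro l hl
    have a := mgf_n (gibbs θ) (gX θ u l) (gibbs_nonneg θ) (gibbs_sum θ)
      (gX_mean θ hsymm hdiag u l (Finset.ne_of_mem_erase hl)) (gX_sq θ hsymm hdiag u l) s
      (hsX l) n
    have b := mgf_n (gibbs θ) (gX θ u l) (gibbs_nonneg θ) (gibbs_sum θ)
      (gX_mean θ hsymm hdiag u l (Finset.ne_of_mem_erase hl)) (gX_sq θ hsymm hdiag u l) (-s)
      (hsX' l) n
    rw [neg_sq, hs2] at b
    rw [hs2] at a
    simp only [mul_add, Finset.sum_add_distrib]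
    linarith
  have hW1 : ∑ σs : Fin n → Fin p → Bool, ∏ k, gibbs θ (σs k) = 1 := by
    rw [← Fintype.sum_pow (gibbs θ), gibbs_sum, one_pow]
  have hg : ∀ (σs : Fin n → Fin p → Bool) l, gradISO n σs u (fun i => θ u i) l =
      (1 / n : ℝ) * ∑ k, gX θ u l (σs k) := fun σs l => rfl
  set F : (Fin n → Fin p → Bool) → Fin p → ℝ := fun σs l =>
    Real.exp (s * ∑ k, gX θ u l (σs k)) + Real.exp (-s * ∑ k, gX θ u l (σs k)) with hF
  have hF0 : ∀ σs l, 0 ≤ F σs l := fun σs l => by positivity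
  have key : ∀ σs : Fin n → Fin p → Bool,
      (∏ k, gibbs θ (σs k)) - Real.exp (-(2 * L)) *
        ∑ l ∈ Finset.univ.erase u, (∏ k, gibbs θ (σs k)) * F σs l ≤
      if (∀ l ∈ Finset.univ.erase u,
        |gradISO n σs u (fun i => θ u i) l| ≤ 2 * s) then ∏ k, gibbs θ (σs k) else 0 := by
    intro σs
    split_ifs with h
    · have : 0 ≤ Real.exp (-(2 * L)) *
        ∑ l ∈ Finset.univ.erase u, (∏ k, gibbs θ (σs k)) * F σs l :=
        mul_nonneg (Real.exp_pos _).le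
          (Finset.sum_nonneg fun l _ => mul_nonneg (hW σs) (hF0 σs l))
      linarith
    · push Not at h
      obtain ⟨l, hl, hlt⟩ := h
      have hbig : Real.exp (2 * L) ≤ F σs l := by
        rw [hg, abs_mul, abs_of_nonneg (by positivity), one_div, inv_mul_eq_div,
          lt_div_iff₀ hn0] at hlt
        have h2 : 2 * L ≤ s * |∑ k, gX θ u l (σs k)| := by
          nlinarith [mul_le_mul_of_nonneg_left hlt.le hs0]
        have p1 := Real.exp_pos (s * ∑ k, gX θ u l (σs k))
        have p2 := Real.exp_pos (-s * ∑ k, gX θ u l (σs k))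
        rcases abs_cases (∑ k, gX θ u l (σs k)) with ⟨e, _⟩ | ⟨e, _⟩ <;> rw [e] at h2
        · have := Real.exp_le_exp.2 h2
          simp only [hF]; linarith
        · rw [mul_neg, ← neg_mul] at h2
          have := Real.exp_le_exp.2 h2
          simp only [hF]; linarith
      have h3 : (∏ k, gibbs θ (σs k)) * F σs l ≤
          ∑ l ∈ Finset.univ.erase u, (∏ k, gibbs θ (σs k)) * F σs l :=
        Finset.single_le_sum (f := fun l => (∏ k, gibbs θ (σs k)) * F σs l)
          (fun l _ => mul_nonneg (hW σs) (hF0 σs l)) hl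
      have h4 := (mul_le_mul_of_nonneg_left hbig (hW σs)).trans h3
      have h5 := mul_le_mul_of_nonneg_left h4 (Real.exp_pos (-(2 * L))).le
      have h6 : Real.exp (-(2 * L)) * ((∏ k, gibbs θ (σs k)) * Real.exp (2 * L)) =
          ∏ k, gibbs θ (σs k) := by
        have : Real.exp (-(2 * L)) * Real.exp (2 * L) = 1 := by rw [← Real.exp_add]; simp
        linear_combination (∏ k, gibbs θ (σs k)) * this
      linarith
  refine ge_iff_le.2 (le_trans ?_ (Finset.sum_le_sum fun σs _ =>
    (key σs).trans (le_of_eq (by congr))))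
  rw [Finset.sum_sub_distrib, hW1, ← Finset.mul_sum, Finset.sum_comm]
  have h7 := Finset.sum_le_card_nsmul (Finset.univ.erase u) _ _ hm
  have hcard : (((Finset.univ.erase u).card : ℕ) : ℝ) ≤ p := by
    have := Finset.card_le_univ (Finset.univ.erase u)
    rw [Fintype.card_fin] at this
    exact_mod_cast this
  rw [nsmul_eq_mul] at h7
  have h8 := h7.trans (mul_le_mul_of_nonneg_right hcard (by positivity : 0 ≤ 2 * Real.exp L))
  have h9 := mul_le_mul_of_nonneg_left h8 (Real.exp_pos (-(2 * L))).le
  have h10 : Real.exp (-(2 * L)) * (p * (2 * Real.exp L)) = ε₃ := by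
    have : Real.exp (-(2 * L)) * Real.exp L = Real.exp (-L) := by
      rw [← Real.exp_add]; congr 1; ring
    calc _ = 2 * p * (Real.exp (-(2 * L)) * Real.exp L) := by ring
      _ = ε₃ := by rw [this, hexpL]; field_simp
  linarith
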